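/- arXiv:1703.05409 — 2 statements merged into one kernel-verified Lean document; each statement's English description precedes it below -/
import Mathlib

section
/- For every n ≥ 1, all complex roots of the independence polynomial I(H_n,x) of the n-caterpillar are real. -/
open Polynomial

noncomputable def indepPoly {V : Type*} [Finite V] (G : SimpleGraph V) : Polynomial ℝ :=
  haveI := Fintype.ofFinite V
  haveI := Classical.decPred fun s : Finset V => ∀ u ∈ s, ∀ v ∈ s, ¬G.Adj u v
  ∑ s ∈ Finset.univ.filter (fun s : Finset V => ∀ u ∈ s, ∀ v ∈ s, ¬G.Adj u v), X ^ s.card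


/-- The `n`-caterpillar: a path on `n` vertices `(i, 0)` with two pendant vertices
`(i, 1)` and `(i, 2)` attached to each path vertex. -/
def caterpillar (n : ℕ) : SimpleGraph (Fin n × Fin 3) :=
  SimpleGraph.fromRel (fun a b =>
    (a.2 = 0 ∧ b.2 = 0 ∧ (a.1 : ℕ) + 1 = (b.1 : ℕ)) ∨
    (a.1 = b.1 ∧ a.2 = 0 ∧ b.2 ≠ 0))

/-- Validity of a column encoding. -/
def ColOK (n : ℕ) (fl : Bool) (a : Fin n → Finset (Fin 3)) : Prop :=
  (∀ i, (0 : Fin 3) ∈ a i → a i = {0}) ∧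
  (∀ i j : Fin n, (i : ℕ) + 1 = (j : ℕ) → ¬ ((0 : Fin 3) ∈ a i ∧ (0 : Fin 3) ∈ a j)) ∧
  (∀ i : Fin n, (i : ℕ) = 0 → fl = true → (0 : Fin 3) ∉ a i)

open Classical in
/-- Transfer sums. -/
noncomputable def colSum (z : ℂ) (n : ℕ) (fl : Bool) : ℂ :=
  ∑ a : Fin n → Finset (Fin 3), if ColOK n fl a then z ^ (∑ i, (a i).card) else 0

lemma colOK_cons (n : ℕ) (fl : Bool) (b : Finset (Fin 3)) (a : Fin n → Finset (Fin 3)) :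
    ColOK (n + 1) fl (Fin.cons b a : Fin (n + 1) → Finset (Fin 3)) ↔
      (((0 : Fin 3) ∈ b → b = {0}) ∧ (fl = true → (0 : Fin 3) ∉ b)) ∧
        ColOK n (decide ((0 : Fin 3) ∈ b)) a := by
  unfold ColOK
  constructor
  · rintro ⟨h1, h2, h3⟩
    refine ⟨⟨by simpa using h1 0, by simpa using h3 0⟩, fun i => by simpa using h1 i.succ,
      fun i j hij => ?_, fun i hi hb => ?_⟩
    · simpa using h2 i.succ j.succ (by simpa using hij)
    · have := h2 0 i.succ (by simp [hi])
      simp at this hb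
      exact this hb
  · rintro ⟨⟨h1, h2⟩, h3, h4, h5⟩
    refine ⟨fun i => ?_, fun i j => ?_, fun i => ?_⟩
    · refine Fin.cases ?_ (fun i => ?_) i
      · simpa using h1
      · simpa using h3 i
    · refine Fin.cases ?_ (fun j => ?_) j
      · simp
      · refine Fin.cases ?_ (fun i => ?_) i
        · intro h ⟨h6, h7⟩
          simp at h h6 h7
          exact h5 j (by omega) (by simpa using h6) h7
        · intro h
          simpa using h4 i j (by simpa using h)
    · refine Fin.cases ?_ (fun i => ?_) i
      · simpa using h2
      · simp

lemma univ_fin3 : (Finset.univ : Finset (Finset (Fin 3))) =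
    {∅, {0}, {1}, {2}, {0,1}, {0,2}, {1,2}, {0,1,2}} := by decide

open Classical in
lemma colSum_succ (z : ℂ) (n : ℕ) (fl : Bool) :
    colSum z (n + 1) fl = (1 + z) ^ 2 * colSum z n false +
      if fl = true then 0 else z * colSum z n true := by
  have key : colSum z (n + 1) fl = ∑ b : Finset (Fin 3),
      if (((0 : Fin 3) ∈ b → b = {0}) ∧ (fl = true → (0 : Fin 3) ∉ b)) then
        z ^ b.card * colSum z n (decide ((0 : Fin 3) ∈ b)) else 0 := by
    unfold colSum
    rw [← (Fin.consEquiv (fun _ => Finset (Fin 3))).sum_comp, Fintype.sum_prod_type]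
    refine Finset.sum_congr rfl fun b _ => ?_
    simp only [Fin.consEquiv, Equiv.coe_fn_mk, colOK_cons, Fin.sum_univ_succ, Fin.cons_zero,
      Fin.cons_succ, pow_add, Finset.mul_sum]
    split_ifs with h
    · refine Finset.sum_congr rfl fun a _ => ?_
      by_cases hc : ColOK n (decide ((0 : Fin 3) ∈ b)) a
      · rw [if_pos ⟨h, hc⟩, if_pos hc]
      · rw [if_neg (fun h' => hc h'.2), if_neg hc, mul_zero]
    · refine Finset.sum_eq_zero fun a _ => ?_
      rw [if_neg (fun h' => h h'.1)]
  have t : ∀ b : Finset (Fin 3), ((0 : Fin 3) ∈ b → b = {0}) ↔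
      b ∉ ({{0,1}, {0,2}, {0,1,2}} : Finset (Finset (Fin 3))) := by decide
  rw [key, univ_fin3]
  rw [Finset.sum_insert (by decide), Finset.sum_insert (by decide), Finset.sum_insert (by decide),
    Finset.sum_insert (by decide), Finset.sum_insert (by decide), Finset.sum_insert (by decide),
    Finset.sum_insert (by decide), Finset.sum_singleton]
  have e1 : ({0, 1} : Finset (Fin 3)) ≠ {0} := by decide
  have e2 : ({0, 2} : Finset (Fin 3)) ≠ {0} := by decide
  have e3 : ({0, 1, 2} : Finset (Fin 3)) ≠ {0} := by decide
  have e4 : ({1, 2} : Finset (Fin 3)).card = 2 := by decide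
  cases fl <;> simp [e1, e2, e3, e4] <;> ring

lemma colSum_zero (z : ℂ) (fl : Bool) : colSum z 0 fl = 1 := by
  simp [colSum, ColOK]

lemma card_cols (n : ℕ) (s : Finset (Fin n × Fin 3)) :
    s.card = ∑ i, (Finset.univ.filter (fun j => (i, j) ∈ s)).card := by
  simp only [Finset.card_filter]
  rw [← Fintype.sum_prod_type (f := fun p => if p ∈ s then 1 else 0)]
  simp

lemma indep_iff (n : ℕ) (s : Finset (Fin n × Fin 3)) :
    (∀ u ∈ s, ∀ v ∈ s, ¬(caterpillar n).Adj u v) ↔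
      ColOK n false (fun i => Finset.univ.filter (fun j => (i, j) ∈ s)) := by
  simp only [caterpillar, SimpleGraph.fromRel_adj, ColOK]
  constructor
  · intro h
    refine ⟨fun i hi => ?_, fun i j hij hh => ?_, by simp⟩
    · simp at hi
      ext j
      simp
      constructor
      · intro hj
        by_contra hne
        exact h _ hi _ hj ⟨by simpa using fun h => hne h.symm, Or.inl (Or.inr ⟨rfl, rfl, hne⟩)⟩
      · rintro rfl; exact hi
    · simp at hh
      refine h _ hh.1 _ hh.2 ⟨?_, Or.inl (Or.inl ⟨rfl, rfl, hij⟩)⟩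
      simp
      rintro rfl
      omega
  · rintro ⟨h1, h2, -⟩
    have main : ∀ u ∈ s, ∀ v ∈ s, ¬ ((u.2 = 0 ∧ v.2 = 0 ∧ (u.1 : ℕ) + 1 = (v.1 : ℕ)) ∨
        (u.1 = v.1 ∧ u.2 = 0 ∧ v.2 ≠ 0)) := by
      rintro ⟨i, a⟩ hu ⟨j, b⟩ hv (⟨h, h', h''⟩ | ⟨h, h', h''⟩)
      · simp at h h' h''
        subst h h'
        exact h2 i j h'' (by simp [hu, hv])
      · simp at h h' h''
        subst h h'
        have := h1 i (by simp [hu])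
        have hb : b ∈ Finset.univ.filter (fun j => (i, j) ∈ s) := by simp [hv]
        rw [this] at hb
        simp at hb
        exact h'' hb
    rintro u hu v hv ⟨-, h | h⟩
    · exact main u hu v hv h
    · exact main v hv u hu h

open Classical in
lemma eval_eq (n : ℕ) (z : ℂ) :
    ((indepPoly (caterpillar n)).map (algebraMap ℝ ℂ)).eval z = colSum z n false := by
  unfold indepPoly colSum
  simp only [Polynomial.map_sum, Polynomial.map_pow, Polynomial.map_X, Polynomial.eval_finsetSum,
    Polynomial.eval_pow, Polynomial.eval_X]
  rw [Finset.sum_filter]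
  refine Finset.sum_bij'
    (fun s _ i => Finset.univ.filter (fun j => (i, j) ∈ s))
    (fun a _ => Finset.univ.filter (fun p => p.2 ∈ a p.1)) ?_ ?_ ?_ ?_ ?_
  · intros; simp
  · intros; simp
  · intro s _; ext p; simp
  · intro a _; funext i; ext j; simp
  · intro s _
    rw [← card_cols]
    simp only [indep_iff]

theorem caterpillar_real_rooted (n : ℕ) (hn : 1 ≤ n) (z : ℂ)
    (hz : ((indepPoly (caterpillar n)).map (algebraMap ℝ ℂ)).IsRoot z) :
    z.im = 0 := by
  rw [Polynomial.IsRoot.def, eval_eq] at hz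
  by_contra him
  obtain ⟨u, hu, hui⟩ : ∃ u : ℂ, z = -u ^ 2 ∧ u.im < 0 := by
    obtain ⟨u, hu⟩ := IsAlgClosed.exists_pow_nat_eq (-z) (n := 2) (by norm_num)
    rcases lt_trichotomy u.im 0 with h | h | h
    · exact ⟨u, by rw [hu]; ring, h⟩
    · exfalso
      apply him
      have : z = -u ^ 2 := by rw [hu]; ring
      rw [this, sq]
      simp [h]
    · exact ⟨-u, by rw [neg_sq, hu]; ring, by simpa using h⟩
  have u0 : u ≠ 0 := by rintro rfl; simp at hui
  have c0 : 1 + z ≠ 0 := by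
    intro h
    apply him
    have := congrArg Complex.im h
    simpa using this
  set w : ℂ := (1 + z) / u with hw
  have w0 : w ≠ 0 := div_ne_zero c0 u0
  have inv_im : ∀ x : ℂ, x.im > 0 → 0 < (-x⁻¹).im := by
    intro x hx
    have : x ≠ 0 := by rintro rfl; simp at hx
    simp only [Complex.neg_im, Complex.inv_im]
    have := Complex.normSq_pos.mpr this
    rw [neg_div, neg_neg]
    positivity
  have wim : 0 < w.im := by
    have e : w = -(-u)⁻¹ + -u := by
      rw [hw, hu]; field_simp
    rw [e, Complex.add_im]
    have := inv_im (-u) (by simpa using hui)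
    have h2 : (-u).im > 0 := by simpa using hui
    linarith
  have claim : ∀ m, colSum z m false ≠ 0 ∧ colSum z m true ≠ 0 ∧
      0 < (w * colSum z m false / colSum z m true).im := by
    intro m
    induction m with
    | zero => simp [colSum_zero, wim]
    | succ m ih =>
      obtain ⟨hA, hB, hI⟩ := ih
      have eB : colSum z (m + 1) true = (1 + z) ^ 2 * colSum z m false := by
        simp [colSum_succ]
      have eA : colSum z (m + 1) false =
          (1 + z) ^ 2 * colSum z m false + z * colSum z m true := by
        simp [colSum_succ]
      have hB' : colSum z (m + 1) true ≠ 0 := by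
        rw [eB]; exact mul_ne_zero (pow_ne_zero _ c0) hA
      have hI' : 0 < (w * colSum z (m + 1) false / colSum z (m + 1) true).im := by
        have e : w * colSum z (m + 1) false / colSum z (m + 1) true =
            w + -(w * colSum z m false / colSum z m true)⁻¹ := by
          rw [eA, eB, hw]
          generalize colSum z m false = A at *
          generalize colSum z m true = B at *
          generalize hc : 1 + z = c at c0
          rw [hu]
          field_simp
        rw [e, Complex.add_im]
        have := inv_im _ hI
        linarith
      refine ⟨?_, hB', hI'⟩
      intro h
      rw [h] at hI'
      simp at hI'
  exact (claim n).1 hz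
end

section
/- For every n ≥ 1, the coefficient sequence (i_k(F_n))_k of the independence polynomial of the n-th Fibonacci tree is log-concave, hence unimodal. -/
open Polynomial

/-- The number of independent sets of size `k` in `G`. -/
noncomputable def indepNum {V : Type*} [Finite V] (G : SimpleGraph V) (k : ℕ) : ℕ :=
  haveI := Fintype.ofFinite V
  haveI := Classical.decPred
    fun s : Finset V => s.card = k ∧ ∀ u ∈ s, ∀ v ∈ s, ¬G.Adj u v
  (Finset.univ.filter
    (fun s : Finset V => s.card = k ∧ ∀ u ∈ s, ∀ v ∈ s, ¬G.Adj u v)).card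

/-- Vertex type of the `n`-th Fibonacci tree. -/
def FibV : ℕ → Type
  | 0 => Unit
  | 1 => Bool
  | (n + 2) => FibV (n + 1) ⊕ FibV n ⊕ Unit

instance fibVFinite : ∀ n, Finite (FibV n)
  | 0 => inferInstanceAs (Finite Unit)
  | 1 => inferInstanceAs (Finite Bool)
  | (n + 2) =>
    haveI := fibVFinite (n + 1)
    haveI := fibVFinite n
    inferInstanceAs (Finite (FibV (n + 1) ⊕ FibV n ⊕ Unit))

/-- The root of the `n`-th Fibonacci tree. -/
def fibRoot : (n : ℕ) → FibV n
  | 0 => ()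
  | 1 => true
  | (_ + 2) => Sum.inr (Sum.inr ())

/-- The `n`-th Fibonacci tree: `F₀ = K₁`, `F₁ = K₂`, and `Fₙ` is a new root joined to the
roots of disjoint copies of `Fₙ₋₁` and `Fₙ₋₂`. -/
def fibGraph : (n : ℕ) → SimpleGraph (FibV n)
  | 0 => ⊥
  | 1 => ⊤
  | (n + 2) =>
    SimpleGraph.fromRel (fun a b =>
      match a, b with
      | Sum.inl a, Sum.inl b => (fibGraph (n + 1)).Adj a b
      | Sum.inr (Sum.inl a), Sum.inr (Sum.inl b) => (fibGraph n).Adj a b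
      | Sum.inr (Sum.inr _), Sum.inl b => b = fibRoot (n + 1)
      | Sum.inr (Sum.inr _), Sum.inr (Sum.inl b) => b = fibRoot n
      | _, _ => False)

/-- Toeplitz matrix of the coefficients. -/
noncomputable def toep (P : ℕ[X]) (p k : ℕ) : ℤ := if k ≤ p then (P.coeff (p - k) : ℤ) else 0

/-- Strong log-concavity: 2x2 minors of the Toeplitz matrix are nonnegative. -/
def SLC (P : ℕ[X]) : Prop := ∀ p₁ p₂ k₁ k₂ : ℕ, p₁ ≤ p₂ → k₁ ≤ k₂ →
  toep P p₁ k₂ * toep P p₂ k₁ ≤ toep P p₁ k₁ * toep P p₂ k₂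

lemma toep_mul (P Q : ℕ[X]) (N p q : ℕ) (hp : p ≤ N) :
    toep (P * Q) p q = ∑ k ∈ Finset.range (N + 1), toep P p k * toep Q k q := by
  by_cases hq : q ≤ p
  · have h1 : ∑ k ∈ Finset.range (N + 1), toep P p k * toep Q k q
        = ∑ k ∈ Finset.Ico q (p + 1), toep P p k * toep Q k q := by
      symm
      apply Finset.sum_subset
      · intro k; simp only [Finset.mem_Ico, Finset.mem_range]; omega
      · intro k _ hk
        simp only [Finset.mem_Ico, not_and, not_lt] at hk
        by_cases h : q ≤ k
        · have := hk h
          simp [toep, show ¬ k ≤ p by omega]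
        · simp [toep, h]
    rw [h1, Finset.sum_Ico_eq_sum_range]
    simp only [toep, hq, if_true]
    rw [mul_comm P Q, coeff_mul, Finset.Nat.sum_antidiagonal_eq_sum_range_succ_mk]
    push_cast
    rw [show p + 1 - q = (p - q) + 1 by omega]
    apply Finset.sum_congr rfl
    intro k hk
    rw [Finset.mem_range] at hk
    rw [if_pos (by omega), if_pos (by omega), mul_comm, show p - (q + k) = p - q - k by omega,
      show q + k - q = k by omega]
  · rw [Finset.sum_eq_zero]
    · simp [toep, hq]
    · intro k _
      by_cases h : k ≤ p
      · simp [toep, show ¬ q ≤ k by omega]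
      · simp [toep, h]

lemma cauchy_binet_ineq (s : Finset ℕ) (x y u v : ℕ → ℤ)
    (h : ∀ k l, 0 ≤ (x k * y l - x l * y k) * (u k * v l - u l * v k)) :
    (∑ k ∈ s, x k * v k) * (∑ k ∈ s, y k * u k) ≤
      (∑ k ∈ s, x k * u k) * (∑ k ∈ s, y k * v k) := by
  have h0 : 0 ≤ ∑ k ∈ s, ∑ l ∈ s, (x k * y l - x l * y k) * (u k * v l - u l * v k) :=
    Finset.sum_nonneg fun k _ => Finset.sum_nonneg fun l _ => h k l
  have h1 : ∑ k ∈ s, ∑ l ∈ s, (x k * y l - x l * y k) * (u k * v l - u l * v k) =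
      ∑ k ∈ s, ∑ l ∈ s, ((x k * u k) * (y l * v l) - (x k * v k) * (y l * u l)
        - (y k * u k) * (x l * v l) + (y k * v k) * (x l * u l)) := by
    refine Finset.sum_congr rfl fun k _ => Finset.sum_congr rfl fun l _ => ?_
    ring
  rw [h1] at h0
  simp only [Finset.sum_add_distrib, Finset.sum_sub_distrib, ← Finset.sum_mul_sum] at h0
  linarith

lemma SLC.mul {P Q : ℕ[X]} (hP : SLC P) (hQ : SLC Q) : SLC (P * Q) := by
  intro p₁ p₂ k₁ k₂ hp hk
  rw [toep_mul P Q p₂ p₁ k₂ hp, toep_mul P Q p₂ p₂ k₁ le_rfl, toep_mul P Q p₂ p₁ k₁ hp,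
    toep_mul P Q p₂ p₂ k₂ le_rfl]
  apply cauchy_binet_ineq
  intro k l
  rcases le_total k l with h | h
  · have a1 := hP p₁ p₂ k l hp h
    have a2 := hQ k l k₁ k₂ h hk
    apply mul_nonneg <;> nlinarith
  · have a1 := hP p₁ p₂ l k hp h
    have a2 := hQ l k k₁ k₂ h hk
    apply mul_nonneg_of_nonpos_of_nonpos <;> nlinarith

lemma SLC_of {P : ℕ[X]} (h : ∀ i d e, P.coeff i * P.coeff (i + d + e) ≤
    P.coeff (i + d) * P.coeff (i + e)) : SLC P := by
  intro p₁ p₂ k₁ k₂ hp hk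
  by_cases h1 : k₂ ≤ p₁
  · have := h (p₁ - k₂) (k₂ - k₁) (p₂ - p₁)
    simp only [toep]
    rw [if_pos h1, if_pos (by omega), if_pos (by omega), if_pos (by omega)]
    rw [show p₁ - k₂ + (k₂ - k₁) + (p₂ - p₁) = p₂ - k₁ by omega,
      show p₁ - k₂ + (k₂ - k₁) = p₁ - k₁ by omega,
      show p₁ - k₂ + (p₂ - p₁) = p₂ - k₂ by omega] at this
    exact_mod_cast this
  · have : toep P p₁ k₂ = 0 := by simp [toep, h1]
    rw [this, zero_mul]
    unfold toep
    split_ifs <;> positivity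

lemma SLC.coeff {P : ℕ[X]} (h : SLC P) (i d e : ℕ) :
    P.coeff i * P.coeff (i + d + e) ≤ P.coeff (i + d) * P.coeff (i + e) := by
  have := h (i + d) (i + d + e) 0 d (by omega) (by omega)
  simp only [toep] at this
  rw [if_pos (by omega), if_pos (by omega), if_pos (by omega), if_pos (by omega)] at this
  rw [show i + d - d = i by omega, show i + d + e - d = i + e by omega] at this
  exact_mod_cast this

lemma SLC_one : SLC 1 := by
  apply SLC_of
  intro i d e
  rcases Nat.eq_zero_or_pos (i + d + e) with h | h
  · obtain ⟨rfl, rfl, rfl⟩ : i = 0 ∧ d = 0 ∧ e = 0 := by omega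
    simp
  · rw [show (1 : ℕ[X]).coeff (i + d + e) = 0 by rw [coeff_one]; simp; omega]
    simp

/-- Independence polynomials of squares of paths. -/
noncomputable def gpoly : ℕ → ℕ[X]
  | 0 => 1
  | 1 => 1
  | 2 => 1
  | (m + 3) => gpoly (m + 2) + X * gpoly m

lemma gpoly_coeff : ∀ m k, (gpoly m).coeff k = Nat.choose (m - 2 * k) k
  | 0, k => by
    rw [gpoly, coeff_one]; cases k <;> simp
  | 1, k => by
    rw [gpoly, coeff_one]; rcases k with _ | k
    · simp
    · simp [show 1 - 2 * (k + 1) = 0 by omega]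
  | 2, k => by
    rw [gpoly, coeff_one]; rcases k with _ | k
    · simp
    · simp
  | (m + 3), 0 => by
    rw [gpoly, coeff_add, gpoly_coeff (m + 2) 0]; simp
  | (m + 3), (k + 1) => by
    rw [gpoly, coeff_add, coeff_X_mul, gpoly_coeff (m + 2), gpoly_coeff m]
    by_cases h : 2 * k ≤ m
    · rw [show m + 3 - 2 * (k + 1) = (m - 2 * k) + 1 by omega,
        show m + 2 - 2 * (k + 1) = m - 2 * k by omega, Nat.choose_succ_succ, add_comm]
    · rw [show m + 3 - 2 * (k + 1) = 0 by omega, show m + 2 - 2 * (k + 1) = 0 by omega,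
        show m - 2 * k = 0 by omega]
      obtain ⟨k, rfl⟩ : ∃ l, k = l + 1 := ⟨k - 1, by omega⟩
      simp

lemma gch_step (j r : ℕ) :
    Nat.choose (j + r + 1) (j + 1) * ((j + 1) * ((j + r + 3) * (j + r + 2))) =
      Nat.choose (j + r + 3) j * ((r + 3) * ((r + 2) * (r + 1))) := by
  have h1 := Nat.choose_succ_right_eq (j + r + 1) j
  have h2 := Nat.choose_mul_succ_eq (j + r + 1) j
  have h3 := Nat.choose_mul_succ_eq (j + r + 2) j
  rw [show j + r + 1 - j = r + 1 by omega] at h1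
  rw [show j + r + 1 + 1 - j = r + 2 by omega] at h2
  rw [show j + r + 2 + 1 - j = r + 3 by omega] at h3
  rw [show j + r + 1 + 1 = j + r + 2 by omega] at h2
  rw [show j + r + 2 + 1 = j + r + 3 by omega] at h3
  calc _ = (Nat.choose (j + r + 1) (j + 1) * (j + 1)) * ((j + r + 3) * (j + r + 2)) := by ring
    _ = (Nat.choose (j + r + 1) j * (j + r + 2)) * ((r + 1) * (j + r + 3)) := by rw [h1]; ring
    _ = (Nat.choose (j + r + 2) j * (j + r + 3)) * ((r + 1) * (r + 2)) := by rw [h2]; ring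
    _ = _ := by rw [h3]; ring

lemma gpoly_adj (m i t : ℕ) :
    (gpoly m).coeff i * (gpoly m).coeff (i + t + 1) ≤
      (gpoly m).coeff (i + 1) * (gpoly m).coeff (i + t) := by
  simp only [gpoly_coeff]
  by_cases h : 3 * (i + t + 1) ≤ m
  · obtain ⟨r, rfl⟩ : ∃ r, m = 3 * (i + t + 1) + r := ⟨m - 3 * (i + t + 1), by omega⟩
    have hj := gch_step (i + t) r
    have hi := gch_step i (3 * t + r)
    rw [show 3 * (i + t + 1) + r - 2 * i = i + (3 * t + r) + 3 by omega,
      show 3 * (i + t + 1) + r - 2 * (i + 1) = i + (3 * t + r) + 1 by omega,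
      show 3 * (i + t + 1) + r - 2 * (i + t + 1) = i + t + r + 1 by omega,
      show 3 * (i + t + 1) + r - 2 * (i + t) = i + t + r + 3 by omega]
    set a0 := Nat.choose (i + (3 * t + r) + 3) i
    set a1 := Nat.choose (i + (3 * t + r) + 1) (i + 1)
    set b0 := Nat.choose (i + t + r + 3) (i + t)
    set b1 := Nat.choose (i + t + r + 1) (i + t + 1)
    have key : ((r + 3) * ((r + 2) * (r + 1))) *
          ((i + 1) * ((i + (3 * t + r) + 3) * (i + (3 * t + r) + 2))) ≤
        ((3 * t + r + 3) * ((3 * t + r + 2) * (3 * t + r + 1))) *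
          ((i + t + 1) * ((i + t + r + 3) * (i + t + r + 2))) := by
      have e1 : (r + 3) * (i + (3 * t + r) + 3) ≤ (3 * t + r + 3) * (i + t + r + 3) := by nlinarith
      have e2 : (r + 1) * (i + (3 * t + r) + 2) ≤ (3 * t + r + 1) * (i + t + r + 2) := by nlinarith
      have e3 : (r + 2) * (i + 1) ≤ (3 * t + r + 2) * (i + t + 1) := by
        apply Nat.mul_le_mul <;> omega
      have := Nat.mul_le_mul (Nat.mul_le_mul e1 e2) e3
      calc _ = _ := by ring
        _ ≤ _ := this
        _ = _ := by ring
    have hpos : 0 < ((i + t + 1) * ((i + t + r + 3) * (i + t + r + 2))) *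
      ((i + 1) * ((i + (3 * t + r) + 3) * (i + (3 * t + r) + 2))) := by positivity
    refine Nat.le_of_mul_le_mul_right ?_ hpos
    calc _ = a0 * (b1 * ((i + t + 1) * ((i + t + r + 3) * (i + t + r + 2)))) *
          ((i + 1) * ((i + (3 * t + r) + 3) * (i + (3 * t + r) + 2))) := by ring
      _ = (a0 * b0) * (((r + 3) * ((r + 2) * (r + 1))) *
          ((i + 1) * ((i + (3 * t + r) + 3) * (i + (3 * t + r) + 2)))) := by rw [hj]; ring
      _ ≤ (a0 * b0) * (((3 * t + r + 3) * ((3 * t + r + 2) * (3 * t + r + 1))) *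
          ((i + t + 1) * ((i + t + r + 3) * (i + t + r + 2)))) := Nat.mul_le_mul_left _ key
      _ = (a0 * ((3 * t + r + 3) * ((3 * t + r + 2) * (3 * t + r + 1)))) * b0 *
          ((i + t + 1) * ((i + t + r + 3) * (i + t + r + 2))) := by ring
      _ = _ := by rw [← hi]; ring
  · rw [Nat.choose_eq_zero_of_lt (show m - 2 * (i + t + 1) < i + t + 1 by omega)]
    simp

lemma gpoly_pos_mono (m i j : ℕ) (hij : i ≤ j) (h : 0 < (gpoly m).coeff j) :
    0 < (gpoly m).coeff i := by
  rw [gpoly_coeff] at *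
  have : j ≤ m - 2 * j := by
    by_contra hc
    rw [Nat.choose_eq_zero_of_lt (by omega)] at h
    exact absurd h (lt_irrefl _)
  exact Nat.choose_pos (by omega)

lemma gpoly_SLC (m : ℕ) : SLC (gpoly m) := by
  apply SLC_of
  intro i d e
  induction d with
  | zero => simp
  | succ d ih =>
    have h := gpoly_adj m (i + d) e
    rcases Nat.eq_zero_or_pos ((gpoly m).coeff (i + d + e)) with h0 | h0
    · have : (gpoly m).coeff (i + (d + 1) + e) = 0 := by
        by_contra hc
        have := gpoly_pos_mono m (i + d + e) (i + (d + 1) + e) (by omega) (Nat.pos_of_ne_zero hc)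
        omega
      simp [this]
    · have h1 := gpoly_pos_mono m (i + d) (i + d + e) (by omega) h0
      rw [show i + (d + 1) + e = i + d + e + 1 by ring, show i + (d + 1) = i + d + 1 by ring]
      refine Nat.le_of_mul_le_mul_right ?_ (Nat.mul_pos h0 h1)
      calc _ = ((gpoly m).coeff i * (gpoly m).coeff (i + d + e)) *
            ((gpoly m).coeff (i + d) * (gpoly m).coeff (i + d + e + 1)) := by ring
        _ ≤ _ := Nat.mul_le_mul ih h
        _ = _ := by ring

/-! Combinatorics -/

/-- Independence of a vertex set. -/
def Ind (n : ℕ) (s : Finset (FibV n)) : Prop := ∀ u ∈ s, ∀ v ∈ s, ¬(fibGraph n).Adj u v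

noncomputable instance fibVFintype (n : ℕ) : Fintype (FibV n) := Fintype.ofFinite _

open Classical in
/-- Independence polynomial. -/
noncomputable def Ipoly (n : ℕ) : ℕ[X] :=
  ∑ s : Finset (FibV n), if Ind n s then X ^ s.card else 0

open Classical in
/-- Independence polynomial restricted to sets avoiding the root. -/
noncomputable def Apoly (n : ℕ) : ℕ[X] :=
  ∑ s : Finset (FibV n), if Ind n s ∧ fibRoot n ∉ s then X ^ s.card else 0

lemma Ipoly_coeff (n k : ℕ) : (Ipoly n).coeff k = indepNum (fibGraph n) k := by
  classical
  unfold Ipoly indepNum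
  rw [finsetSum_coeff, Finset.card_filter]
  refine Finset.sum_congr rfl fun s _ => ?_
  by_cases h : Ind n s
  · have h' : ∀ u ∈ s, ∀ v ∈ s, ¬(fibGraph n).Adj u v := h
    simp only [h, if_true, coeff_X_pow]
    by_cases hk : k = s.card
    · rw [if_pos hk, if_pos ⟨hk.symm, h'⟩]
    · rw [if_neg hk, if_neg fun hh => hk hh.1.symm]
  · rw [if_neg h, if_neg fun hh => h hh.2]; simp

/-- Splitting a vertex set. -/
def mk2 (n : ℕ) (a : Finset (FibV (n + 1))) (b : Finset (FibV n)) (c : Finset Unit) :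
    Finset (FibV (n + 2)) :=
  (a.disjSum (b.disjSum c) : Finset (FibV (n + 1) ⊕ FibV n ⊕ Unit))

lemma sum_mk2 (n : ℕ) (f : Finset (FibV (n + 2)) → ℕ[X]) :
    ∑ s, f s = ∑ a, ∑ b, (f (mk2 n a b ∅) + f (mk2 n a b {()})) := by
  classical
  have hu : ∀ g : Finset Unit → ℕ[X], ∑ c, g c = g ∅ + g {()} := by
    intro g
    rw [show (Finset.univ : Finset (Finset Unit)) = {∅, {()}} by decide]
    rw [Finset.sum_pair (by decide)]
  let e : Finset (FibV (n + 2)) ≃ Finset (FibV (n + 1)) × Finset (FibV n) × Finset Unit :=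
    (Finset.sumEquiv (α := FibV (n + 1)) (β := FibV n ⊕ Unit)).toEquiv.trans
      (Equiv.prodCongr (Equiv.refl _) (Finset.sumEquiv (α := FibV n) (β := Unit)).toEquiv)
  rw [← Equiv.sum_comp e.symm, Fintype.sum_prod_type]
  refine Finset.sum_congr rfl fun a _ => ?_
  rw [Fintype.sum_prod_type]
  refine Finset.sum_congr rfl fun b _ => ?_
  rw [hu]
  rfl

lemma mk2_card (n : ℕ) (a b c) : (mk2 n a b c).card = a.card + (b.card + c.card) := by
  unfold mk2
  erw [Finset.card_disjSum, Finset.card_disjSum]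

/-- Vertex of the left subtree. -/
def va (n : ℕ) (a : FibV (n + 1)) : FibV (n + 2) := (Sum.inl a : FibV (n + 1) ⊕ FibV n ⊕ Unit)
/-- Vertex of the right subtree. -/
def vb (n : ℕ) (b : FibV n) : FibV (n + 2) := (Sum.inr (Sum.inl b) : FibV (n + 1) ⊕ FibV n ⊕ Unit)
/-- The new root. -/
def vc (n : ℕ) (c : Unit) : FibV (n + 2) := (Sum.inr (Sum.inr c) : FibV (n + 1) ⊕ FibV n ⊕ Unit)

lemma mk2_all (n : ℕ) (a b c) (p : FibV (n + 2) → Prop) :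
    (∀ u ∈ mk2 n a b c, p u) ↔ (∀ u ∈ a, p (va n u)) ∧ (∀ u ∈ b, p (vb n u)) ∧
      (∀ u ∈ c, p (vc n u)) := by
  constructor
  · intro h
    refine ⟨fun u hu => h _ ?_, fun u hu => h _ ?_, fun u hu => h _ ?_⟩
    · exact Finset.inl_mem_disjSum.2 hu
    · exact Finset.inr_mem_disjSum.2 (Finset.inl_mem_disjSum.2 hu)
    · exact Finset.inr_mem_disjSum.2 (Finset.inr_mem_disjSum.2 hu)
  · rintro ⟨h1, h2, h3⟩ u hu
    rcases u with u | u | u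
    · exact h1 u (Finset.inl_mem_disjSum.1 hu)
    · exact h2 u (Finset.inl_mem_disjSum.1 (Finset.inr_mem_disjSum.1 hu))
    · exact h3 u (Finset.inr_mem_disjSum.1 (Finset.inr_mem_disjSum.1 hu))

section adj
variable (n : ℕ) (a a' : FibV (n + 1)) (b b' : FibV n) (c c' : Unit)

lemma adj_aa : (fibGraph (n + 2)).Adj (va n a) (va n a') ↔ (fibGraph (n + 1)).Adj a a' := by
  refine (SimpleGraph.fromRel_adj _ _ _).trans ?_
  constructor
  · rintro ⟨_, h | h⟩
    · exact h
    · exact h.symm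
  · intro h
    exact ⟨fun hh => h.ne (Sum.inl.inj hh), Or.inl h⟩

lemma adj_bb : (fibGraph (n + 2)).Adj (vb n b) (vb n b') ↔
    (fibGraph n).Adj b b' := by
  refine (SimpleGraph.fromRel_adj _ _ _).trans ?_
  constructor
  · rintro ⟨_, h | h⟩
    · exact h
    · exact h.symm
  · intro h
    exact ⟨fun hh => h.ne (Sum.inl.inj (Sum.inr.inj hh)), Or.inl h⟩

lemma adj_ab : ¬ (fibGraph (n + 2)).Adj (va n a) (vb n b) := by
  intro h
  rcases (SimpleGraph.fromRel_adj _ _ _).1 h with ⟨_, h | h⟩ <;> exact h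

lemma adj_ca : (fibGraph (n + 2)).Adj (vc n c) (va n a) ↔ a = fibRoot (n + 1) := by
  refine (SimpleGraph.fromRel_adj _ _ _).trans ?_
  constructor
  · rintro ⟨_, h | h⟩
    · exact h
    · exact h.elim
  · intro h
    exact ⟨fun hh => (Sum.inr_ne_inl hh), Or.inl h⟩

lemma adj_cb : (fibGraph (n + 2)).Adj (vc n c) (vb n b) ↔
    b = fibRoot n := by
  refine (SimpleGraph.fromRel_adj _ _ _).trans ?_
  constructor
  · rintro ⟨_, h | h⟩
    · exact h
    · exact h.elim
  · intro h
    exact ⟨fun hh => (Sum.inr_ne_inl (Sum.inr.inj hh)), Or.inl h⟩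
end adj

lemma ind_mk2_empty (n : ℕ) (a b) : Ind (n + 2) (mk2 n a b ∅) ↔ Ind (n + 1) a ∧ Ind n b := by
  unfold Ind
  simp only [mk2_all, adj_aa, adj_bb]
  constructor
  · rintro ⟨h1, h2, _⟩
    exact ⟨fun u hu => (h1 u hu).1, fun u hu => (h2 u hu).2.1⟩
  · rintro ⟨h1, h2⟩
    refine ⟨fun u hu => ⟨h1 u hu, fun v _ => adj_ab n u v, by simp⟩,
      fun u hu => ⟨fun v _ h => adj_ab n v u h.symm, h2 u hu, by simp⟩, by simp⟩

lemma ind_mk2_root (n : ℕ) (a b) : Ind (n + 2) (mk2 n a b {()}) ↔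
    (Ind (n + 1) a ∧ fibRoot (n + 1) ∉ a) ∧ (Ind n b ∧ fibRoot n ∉ b) := by
  unfold Ind
  simp only [mk2_all, adj_aa, adj_bb]
  constructor
  · rintro ⟨h1, h2, h3⟩
    have h3 := h3 () (by simp)
    exact ⟨⟨fun u hu => (h1 u hu).1, fun h => h3.1 _ h ((adj_ca n _ ()).2 rfl)⟩,
      ⟨fun u hu => (h2 u hu).2.1, fun h => h3.2.1 _ h ((adj_cb n _ ()).2 rfl)⟩⟩
  · rintro ⟨⟨h1, h1'⟩, h2, h2'⟩
    have ka : ∀ c, ∀ u ∈ a, ¬ (fibGraph (n + 2)).Adj (vc n c) (va n u) :=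
      fun c u hu h => h1' ((adj_ca n u c).1 h ▸ hu)
    have kb : ∀ c, ∀ u ∈ b, ¬ (fibGraph (n + 2)).Adj (vc n c) (vb n u) :=
      fun c u hu h => h2' ((adj_cb n u c).1 h ▸ hu)
    refine ⟨fun u hu => ⟨h1 u hu, fun v _ => adj_ab n u v, fun c _ h => ka c u hu h.symm⟩,
      fun u hu => ⟨fun v _ h => adj_ab n v u h.symm, h2 u hu, fun c _ h => kb c u hu h.symm⟩,
      fun c _ => ⟨ka c, kb c, fun c' _ h => h.ne rfl⟩⟩

lemma root_mk2 (n : ℕ) (a b c) : fibRoot (n + 2) ∈ mk2 n a b c ↔ () ∈ c :=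
  ⟨fun h => Finset.inr_mem_disjSum.1 (Finset.inr_mem_disjSum.1 h),
   fun h => Finset.inr_mem_disjSum.2 (Finset.inr_mem_disjSum.2 h)⟩

lemma Apoly_rec (n : ℕ) : Apoly (n + 2) = Ipoly (n + 1) * Ipoly n := by
  classical
  rw [Apoly, sum_mk2, Ipoly, Ipoly, Finset.sum_mul_sum]
  refine Finset.sum_congr rfl fun a _ => Finset.sum_congr rfl fun b _ => ?_
  simp only [root_mk2, ind_mk2_empty, mk2_card]
  by_cases h1 : Ind (n + 1) a <;> by_cases h2 : Ind n b <;> simp [h1, h2, pow_add]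

lemma Ipoly_rec (n : ℕ) : Ipoly (n + 2) = Apoly (n + 2) + X * (Apoly (n + 1) * Apoly n) := by
  classical
  rw [Apoly_rec, Ipoly, sum_mk2]
  simp only [Finset.sum_add_distrib]
  congr 1
  · rw [Ipoly, Ipoly, Finset.sum_mul_sum]
    refine Finset.sum_congr rfl fun a _ => Finset.sum_congr rfl fun b _ => ?_
    simp only [ind_mk2_empty, mk2_card]
    by_cases h1 : Ind (n + 1) a <;> by_cases h2 : Ind n b <;> simp [h1, h2, pow_add]
  · rw [Apoly, Apoly, Finset.sum_mul_sum, Finset.mul_sum]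
    refine Finset.sum_congr rfl fun a _ => ?_
    rw [Finset.mul_sum]
    refine Finset.sum_congr rfl fun b _ => ?_
    simp only [ind_mk2_root, mk2_card]
    by_cases h1 : Ind (n + 1) a ∧ fibRoot (n + 1) ∉ a <;>
      by_cases h2 : Ind n b ∧ fibRoot n ∉ b <;> simp only [h1, h2]
    · simp [pow_add]; ring
    all_goals simp

lemma base0 : Ipoly 0 = 1 + X ∧ Apoly 0 = 1 := by
  classical
  have hu : ∀ g : Finset (FibV 0) → ℕ[X], ∑ c, g c = g ∅ + g {fibRoot 0} := by
    intro g
    rw [show (Finset.univ : Finset (Finset (FibV 0))) = {∅, {fibRoot 0}} by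
      ext s
      simp only [Finset.mem_univ, Finset.mem_insert, Finset.mem_singleton, true_iff]
      by_cases h : fibRoot 0 ∈ s
      · right; ext x; simp only [Finset.mem_singleton]
        exact ⟨fun _ => rfl, fun hx => hx ▸ h⟩
      · left; ext x; simp only [Finset.notMem_empty, iff_false]
        exact h]
    rw [Finset.sum_pair (Finset.singleton_ne_empty _).symm]
  have h0 : ∀ s, Ind 0 s := fun s u _ v _ h => h
  constructor
  · rw [Ipoly, hu]; simp [h0]
  · rw [Apoly, hu]; simp [h0]

lemma base1 : Ipoly 1 = 1 + X + X ∧ Apoly 1 = 1 + X := by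
  classical
  have hu : ∀ g : Finset (FibV 1) → ℕ[X], ∑ c, g c =
      g (∅ : Finset Bool) + g ({true} : Finset Bool) + g ({false} : Finset Bool)
        + g (Finset.univ : Finset Bool) := by
    intro g
    have : ∀ g : Finset Bool → ℕ[X], ∑ c, g c = g ∅ + g {true} + g {false} + g Finset.univ := by
      intro g
      rw [show (Finset.univ : Finset (Finset Bool)) = {∅, {true}, {false}, Finset.univ} by decide]
      rw [Finset.sum_insert (by decide), Finset.sum_insert (by decide),
        Finset.sum_pair (by decide)]
      ring
    refine Eq.trans ?_ (this g)
    exact Finset.sum_congr (congrArg (fun i => @Finset.univ (Finset Bool) i)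
      (Subsingleton.elim _ _)) (fun _ _ => rfl)
  have e0 : Ind 1 (∅ : Finset Bool) := fun u hu => absurd hu (Finset.notMem_empty u)
  have es : ∀ b : Bool, Ind 1 ({b} : Finset Bool) := by
    intro b u hu v hv h
    rw [Finset.mem_singleton.1 hu, Finset.mem_singleton.1 hv] at h
    exact h.ne rfl
  have e2 : ¬ Ind 1 (Finset.univ : Finset Bool) := by
    intro h
    have := h (true : Bool) (Finset.mem_univ (α := Bool) true) (false : Bool)
      (Finset.mem_univ (α := Bool) false)
    apply this
    show (⊤ : SimpleGraph Bool).Adj true false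
    simp
  have r0 : fibRoot 1 ∉ (∅ : Finset Bool) := Finset.notMem_empty _
  have r1 : fibRoot 1 ∈ ({true} : Finset Bool) := Finset.mem_singleton_self _
  have r2 : fibRoot 1 ∉ ({false} : Finset Bool) := fun h => by
    have : true = false := Finset.mem_singleton.1 h
    exact absurd this (by decide)
  have c0 : Finset.card (α := FibV 1) (∅ : Finset Bool) = 0 := rfl
  have cs : ∀ b : Bool, Finset.card (α := FibV 1) ({b} : Finset Bool) = 1 := fun _ => rfl
  constructor
  · rw [Ipoly, hu, if_pos e0, if_pos (es _), if_pos (es _), if_neg e2, c0, cs, cs]; ring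
  · rw [Apoly, hu, if_pos ⟨e0, r0⟩, if_neg (fun h => h.2 r1), if_pos ⟨es _, r2⟩,
      if_neg (fun h => e2 h.1), c0, cs]; ring

lemma main_factor (n : ℕ) : ∃ s : ℕ[X], SLC s ∧ Ipoly n = gpoly (n + 3) * s ∧
    Apoly n = gpoly (n + 2) * s := by
  induction n using Nat.twoStepInduction with
  | zero => exact ⟨1, SLC_one, by simp [base0, gpoly], by simp [base0, gpoly]⟩
  | one => exact ⟨1, SLC_one, by simp [base1, gpoly], by simp [base1, gpoly]⟩
  | more n h0 h1 =>
    obtain ⟨s, hs, i0, a0⟩ := h0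
    obtain ⟨t, ht, i1, a1⟩ := h1
    have hA : Apoly (n + 2) = gpoly (n + 2 + 2) * (t * s * gpoly (n + 3)) := by
      rw [Apoly_rec, i0, i1, show n + 1 + 3 = n + 2 + 2 by ring]; ring
    refine ⟨t * s * gpoly (n + 3), (ht.mul hs).mul (gpoly_SLC _), ?_, hA⟩
    rw [Ipoly_rec, hA, a0, a1, show gpoly (n + 2 + 3) = gpoly (n + 2 + 2) + X * gpoly (n + 2) from
      by rw [gpoly], show n + 1 + 2 = n + 3 by ring]
    ring

theorem fibTree_logConcave_unimodal (n : ℕ) (hn : 1 ≤ n) :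
    (∀ k : ℕ, 1 ≤ k →
      indepNum (fibGraph n) (k - 1) * indepNum (fibGraph n) (k + 1) ≤
        indepNum (fibGraph n) k ^ 2) ∧
    ∃ m : ℕ, (∀ i j, i ≤ j → j ≤ m → indepNum (fibGraph n) i ≤ indepNum (fibGraph n) j) ∧
      (∀ i j, m ≤ i → i ≤ j → indepNum (fibGraph n) j ≤ indepNum (fibGraph n) i) := by
  obtain ⟨s, hs, hI, _⟩ := main_factor n
  have hL : SLC (Ipoly n) := hI ▸ (gpoly_SLC _).mul hs
  simp only [← Ipoly_coeff]
  have hc := hL.coeff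
  have hfin : (Set.range (Ipoly n).coeff).Finite := by
    refine ((Finset.finite_toSet ((Finset.range ((Ipoly n).natDegree + 1)).image
      (Ipoly n).coeff)).union (Set.finite_singleton 0)).subset ?_
    rintro _ ⟨k, rfl⟩
    by_cases hk : k < (Ipoly n).natDegree + 1
    · left
      exact Finset.mem_coe.2 (Finset.mem_image_of_mem _ (Finset.mem_range.2 hk))
    · right
      exact coeff_eq_zero_of_natDegree_lt (by omega)
  refine ⟨?_, ?_⟩
  · intro k hk
    obtain ⟨k, rfl⟩ : ∃ l, k = l + 1 := ⟨k - 1, by omega⟩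
    have := hc k 1 1
    rw [sq]
    exact this
  · obtain ⟨m, hm⟩ : ∃ m, ∀ i, (Ipoly n).coeff i ≤ (Ipoly n).coeff m := by
      obtain ⟨_, ⟨⟨m, rfl⟩, hm⟩⟩ := hfin.exists_maximal (Set.range_nonempty _)
      refine ⟨m, fun i => ?_⟩
      rcases le_total ((Ipoly n).coeff i) ((Ipoly n).coeff m) with h | h
      · exact h
      · exact hm ⟨i, rfl⟩ h
    refine ⟨m, ?_, ?_⟩
    · intro i j hij hjm
      rcases Nat.eq_zero_or_pos ((Ipoly n).coeff m) with h0 | h0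
      · have := hm i; omega
      · have h1 := hc i (j - i) (m - j)
        rw [show i + (j - i) + (m - j) = m by omega, show i + (j - i) = j by omega] at h1
        exact Nat.le_of_mul_le_mul_right (h1.trans (Nat.mul_le_mul_left _ (hm _))) h0
    · intro i j hmi hij
      rcases Nat.eq_zero_or_pos ((Ipoly n).coeff m) with h0 | h0
      · have := hm j; omega
      · have h1 := hc m (i - m) (j - i)
        rw [show m + (i - m) + (j - i) = j by omega, show m + (i - m) = i by omega, mul_comm] at h1
        exact Nat.le_of_mul_le_mul_right (h1.trans (Nat.mul_le_mul_left _ (hm _))) h0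
end
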